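/- arXiv:1411.0758 — 2 statements merged into one kernel-verified Lean document; each statement's English description precedes it below -/
import Mathlib

section
/- Let l = 2n+1 be an odd integer with |l| > 1, and let F(t,z) = S_n(t)·S_{n−1}(z) − S_{n−1}(t)·S_n(z) in ℂ[t,z]. Then (z − t) divides F, and the quotient G = F/(z − t) defines a smooth affine curve: there is no point (t₀, z₀) ∈ ℂ² at which G, ∂G/∂t, and ∂G/∂z all vanish simultaneously. -/
open Polynomial

section ChebyshevRecurrence

variable {R : Type*} [CommRing R] {S : ℤ → R[X]}

/-- An integer-indexed statement follows from one value and the equivalence of consecutive ones. -/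
theorem int_forall_of_iff_succ {p : ℤ → Prop} (h0 : p 0) (h : ∀ k, p k ↔ p (k + 1)) (k : ℤ) :
    p k := by
  induction k using Int.induction_on with
  | zero => exact h0
  | succ i ih => exact (h _).1 ih
  | pred i ih => exact (h _).2 (by simpa using ih)

theorem chebyshev_neg_one (hS0 : S 0 = 1) (hS1 : S 1 = X)
    (hSrec : ∀ j : ℤ, S (j + 1) = X * S j - S (j - 1)) : S (0 - 1) = 0 := by
  have h := hSrec 0
  rw [zero_add, hS1, hS0, mul_one] at h
  linear_combination h

theorem chebyshev_sq_add_sq (hS0 : S 0 = 1) (hS1 : S 1 = X)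
    (hSrec : ∀ j : ℤ, S (j + 1) = X * S j - S (j - 1)) (k : ℤ) :
    S k ^ 2 + S (k - 1) ^ 2 - X * S k * S (k - 1) = 1 := by
  have hneg := chebyshev_neg_one hS0 hS1 hSrec
  refine int_forall_of_iff_succ
    (p := fun k ↦ S k ^ 2 + S (k - 1) ^ 2 - X * S k * S (k - 1) = 1) ?_ (fun k ↦ ?_) k
  · rw [hneg, hS0]; ring
  · rw [add_sub_cancel_right, hSrec k]
    constructor <;> intro h <;> linear_combination h

theorem chebyshev_wronskian (hS0 : S 0 = 1) (hS1 : S 1 = X)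
    (hSrec : ∀ j : ℤ, S (j + 1) = X * S j - S (j - 1)) (k : ℤ) :
    (X ^ 2 - 4) * (derivative (S k) * S (k - 1) - S k * derivative (S (k - 1))) =
      S k ^ 2 - S (k - 1) ^ 2 - ((2 * k + 1 : ℤ) : R[X]) := by
  have hneg := chebyshev_neg_one hS0 hS1 hSrec
  refine int_forall_of_iff_succ
    (p := fun k ↦ (X ^ 2 - 4) * (derivative (S k) * S (k - 1) - S k * derivative (S (k - 1))) =
      S k ^ 2 - S (k - 1) ^ 2 - ((2 * k + 1 : ℤ) : R[X])) ?_ (fun k ↦ ?_) k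
  · rw [hneg, hS0]; simp
  · have hq := chebyshev_sq_add_sq hS0 hS1 hSrec k
    rw [add_sub_cancel_right, hSrec k]
    simp only [derivative_sub, derivative_mul, derivative_X]
    push_cast
    constructor <;> intro h
    · linear_combination h - 2 * hq
    · linear_combination h + 2 * hq

end ChebyshevRecurrence

theorem MvPolynomial.eval_aeval_X {σ R : Type*} [CommSemiring R] (v : σ → R) (j : σ) (p : R[X]) :
    MvPolynomial.eval v (Polynomial.aeval (MvPolynomial.X j : MvPolynomial σ R) p) =
      p.eval (v j) := by
  rw [← MvPolynomial.coe_aeval_eq_eval, RingHom.coe_coe, ← Polynomial.aeval_algHom_apply]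
  simp

/-- Let `l = 2n+1` be an odd integer with `|l| > 1` and let
`F(t,z) = S_n(t)·S_{n−1}(z) − S_{n−1}(t)·S_n(z)` in `ℂ[t,z]` (with `t` the variable
`X 0` and `z` the variable `X 1`).  Then `(z − t)` divides `F`, and the quotient
`G = F/(z − t)` defines a smooth affine curve: there is no point `(t₀, z₀) ∈ ℂ²` at
which `G`, `∂G/∂t` and `∂G/∂z` all vanish.  Here `S : ℤ → ℤ[ω]` satisfies `S 0 = 1`,
`S 1 = ω` and `S (j+1) = ω·S j − S (j−1)` for all `j`. -/
theorem statement14 (S : ℤ → Polynomial ℤ)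
    (hS0 : S 0 = 1) (hS1 : S 1 = X)
    (hSrec : ∀ j : ℤ, S (j + 1) = X * S j - S (j - 1))
    (n : ℤ) (hl : 1 < |2 * n + 1|)
    (F : MvPolynomial (Fin 2) ℂ)
    (hF : F = Polynomial.aeval (MvPolynomial.X 0) (S n) *
          Polynomial.aeval (MvPolynomial.X 1) (S (n - 1)) -
        Polynomial.aeval (MvPolynomial.X 0) (S (n - 1)) *
          Polynomial.aeval (MvPolynomial.X 1) (S n)) :
    (MvPolynomial.X 1 - MvPolynomial.X 0) ∣ F ∧
      ∀ G : MvPolynomial (Fin 2) ℂ, F = (MvPolynomial.X 1 - MvPolynomial.X 0) * G →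
        ¬ ∃ t₀ z₀ : ℂ,
          MvPolynomial.eval ![t₀, z₀] G = 0 ∧
          MvPolynomial.eval ![t₀, z₀] (MvPolynomial.pderiv 0 G) = 0 ∧
          MvPolynomial.eval ![t₀, z₀] (MvPolynomial.pderiv 1 G) = 0 := by
  have hl0 : ((2 * n + 1 : ℤ) : ℂ) ≠ 0 := by
    rw [Int.cast_ne_zero]; omega
  have hl1 : ((2 * n + 1 : ℤ) : ℂ) - 1 ≠ 0 := by
    have : (2 * n + 1) - 1 ≠ 0 := by rintro h; simp_all
    exact_mod_cast this
  have hl2 : ((2 * n + 1 : ℤ) : ℂ) + 1 ≠ 0 := by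
    have : (2 * n + 1) + 1 ≠ 0 := by
      rintro h
      rw [show 2 * n + 1 = -1 by omega] at hl
      simp at hl
    exact_mod_cast this
  set P : ℤ → ℂ[X] := fun k ↦ (S k).map (algebraMap ℤ ℂ) with hP
  have hP0 : P 0 = 1 := by simp [hP, hS0]
  have hP1 : P 1 = X := by simp [hP, hS1]
  have hPrec (j : ℤ) : P (j + 1) = X * P j - P (j - 1) := by simp [hP, hSrec]
  have hq := chebyshev_sq_add_sq hP0 hP1 hPrec n
  have hw := chebyshev_wronskian hP0 hP1 hPrec n
  have hSP (k : ℤ) (x : MvPolynomial (Fin 2) ℂ) : aeval x (S k) = aeval x (P k) :=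
    (aeval_map_algebraMap ℂ x (S k)).symm
  simp only [hSP] at hF
  generalize P n = a at *
  generalize P (n - 1) = b at *
  generalize ((2 * n + 1 : ℤ)) = l at *
  clear hP hSP hP0 hP1 hPrec
  have hqe (t : ℂ) : a.eval t ^ 2 + b.eval t ^ 2 - t * a.eval t * b.eval t = 1 := by
    simpa using congrArg (Polynomial.eval t) hq
  have hwe (t : ℂ) : (t ^ 2 - 4) * (a.derivative.eval t * b.eval t -
      a.eval t * b.derivative.eval t) = a.eval t ^ 2 - b.eval t ^ 2 - l := by
    simpa using congrArg (Polynomial.eval t) hw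
  have hmul_ne (t : ℂ) (h : a.eval t ^ 2 - b.eval t ^ 2 = l) : a.eval t * b.eval t ≠ 0 := by
    intro hab
    have hsum : a.eval t ^ 2 + b.eval t ^ 2 = 1 := by linear_combination hqe t + t * hab
    rcases mul_eq_zero.1 hab with h0 | h0
    · exact hl2 (by rw [h0] at h hsum; linear_combination -h - hsum)
    · exact hl1 (by rw [h0] at h hsum; linear_combination -h + hsum)
  refine ⟨?_, ?_⟩
  · have hdvd (p : ℂ[X]) : (MvPolynomial.X 1 - MvPolynomial.X 0 : MvPolynomial (Fin 2) ℂ) ∣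
        aeval (MvPolynomial.X 1) p - aeval (MvPolynomial.X 0) p := by
      simpa only [eval_map_algebraMap] using sub_dvd_eval_sub _ _ (p.map (algebraMap ℂ _))
    obtain ⟨u, hu⟩ := hdvd a
    obtain ⟨v, hv⟩ := hdvd b
    refine ⟨aeval (MvPolynomial.X 0) a * v - aeval (MvPolynomial.X 0) b * u, ?_⟩
    rw [hF]
    linear_combination aeval (MvPolynomial.X 0) a * hv - aeval (MvPolynomial.X 0) b * hu
  rintro G hG ⟨t, z, h, h0, h1⟩
  rw [hF] at hG
  have e := congrArg (MvPolynomial.eval ![t, z]) hG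
  have e0 := congrArg (MvPolynomial.eval ![t, z]) (congrArg (MvPolynomial.pderiv 0) hG)
  have e1 := congrArg (MvPolynomial.eval ![t, z]) (congrArg (MvPolynomial.pderiv 1) hG)
  have e11 := congrArg (MvPolynomial.eval ![t, z])
    (congrArg (MvPolynomial.pderiv 1) (congrArg (MvPolynomial.pderiv 1) hG))
  simp [MvPolynomial.eval_aeval_X, MvPolynomial.pderiv_X, h, h0, h1]
    at e e0 e1 e11
  by_cases htz : t = z
  · subst htz
    have hW : a.derivative.eval t * b.eval t - a.eval t * b.derivative.eval t = 0 := by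
      linear_combination -e1
    have hW' : a.derivative.derivative.eval t * b.eval t -
        a.eval t * b.derivative.derivative.eval t = 0 := by
      linear_combination -e11
    have hab : a.eval t ^ 2 - b.eval t ^ 2 = l := by
      linear_combination (t ^ 2 - 4) * hW - hwe t
    have hdw := congrArg (fun p ↦ (derivative p).eval t) hw
    have hdq := congrArg (fun p ↦ (derivative p).eval t) hq
    simp [derivative_pow] at hdw hdq
    have hs : a.eval t * a.derivative.eval t - b.eval t * b.derivative.eval t = 0 := by
      linear_combination (-1 / 2) * hdw + t * hW + (t ^ 2 - 4) / 2 * hW'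
    have ha : a.derivative.eval t = 0 := by
      refine (mul_eq_zero.1 ?_).resolve_left hl0
      linear_combination (-a.derivative.eval t) * hab + a.eval t * hs - b.eval t * hW
    have hb : b.derivative.eval t = 0 := by
      refine (mul_eq_zero.1 ?_).resolve_left hl0
      linear_combination (-b.derivative.eval t) * hab + b.eval t * hs - a.eval t * hW
    rw [ha, hb] at hdq
    exact hmul_ne t hab (by linear_combination -hdq)
  · have hWt : a.derivative.eval t * b.eval t - a.eval t * b.derivative.eval t = 0 := by
      have ha : (a.derivative.eval t * b.eval t - a.eval t * b.derivative.eval t) * a.eval z =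
          0 := by
        linear_combination (-a.derivative.eval t) * e + a.eval t * e0
      have hb : (a.derivative.eval t * b.eval t - a.eval t * b.derivative.eval t) * b.eval z =
          0 := by
        linear_combination (-b.derivative.eval t) * e + b.eval t * e0
      linear_combination a.eval z * ha + b.eval z * hb - z * b.eval z * ha -
        (a.derivative.eval t * b.eval t - a.eval t * b.derivative.eval t) * hqe z
    have hWz : a.derivative.eval z * b.eval z - a.eval z * b.derivative.eval z = 0 := by
      have ha : (a.derivative.eval z * b.eval z - a.eval z * b.derivative.eval z) * a.eval t =
          0 := by
        linear_combination a.derivative.eval z * e - a.eval z * e1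
      have hb : (a.derivative.eval z * b.eval z - a.eval z * b.derivative.eval z) * b.eval t =
          0 := by
        linear_combination b.derivative.eval z * e - b.eval z * e1
      linear_combination a.eval t * ha + b.eval t * hb - t * b.eval t * ha -
        (a.derivative.eval z * b.eval z - a.eval z * b.derivative.eval z) * hqe t
    have ht : a.eval t ^ 2 - b.eval t ^ 2 = l := by
      linear_combination (t ^ 2 - 4) * hWt - hwe t
    have hz : a.eval z ^ 2 - b.eval z ^ 2 = l := by
      linear_combination (z ^ 2 - 4) * hWz - hwe z
    have hsq : a.eval t ^ 2 - a.eval z ^ 2 = 0 := by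
      refine (mul_eq_zero.1 ?_).resolve_left hl0
      linear_combination (-a.eval t ^ 2) * hz + a.eval z ^ 2 * ht -
        (a.eval t * b.eval z + b.eval t * a.eval z) * e
    have hmul : a.eval t * b.eval t - a.eval z * b.eval z = 0 := by
      refine (mul_eq_zero.1 ?_).resolve_left hl0
      linear_combination (-a.eval t * b.eval t) * hz + a.eval z * b.eval z * ht -
        (a.eval t * a.eval z + b.eval t * b.eval z) * e
    refine hmul_ne t ht ((mul_eq_zero.1 ?_).resolve_left (sub_ne_zero.2 htz))
    linear_combination 2 * hsq - z * hmul - hqe t + hqe z - ht + hz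
end

section
/- Let k = 2m+1 and l = 2n+1 be odd integers with |k| > 1, |l| > 1 and k ≠ l. Then the polynomial F(t,z) = S_n(t)·S_{m−1}(z) − S_{n−1}(t)·S_m(z) is irreducible in ℂ[t,z]. -/
open Polynomial

section

open Polynomial.Bivariate (swap)

theorem resultant_ne_zero_of_le_natDegree_mul_succ {K : Type*} [Field K] {g h : K[X]} {b c : ℕ}
    (hg : g.natDegree ≤ b) (hh : h.natDegree ≤ c) (hgh : IsCoprime g h) (h0 : g * h ≠ 0)
    (hdeg : b + c ≤ (g * h).natDegree + 1) : resultant g h b c ≠ 0 := by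
  have hg0 := left_ne_zero_of_mul h0
  have hh0 := right_ne_zero_of_mul h0
  have key := resultant_ne_zero g h hgh
  rw [natDegree_mul hg0 hh0] at hdeg
  obtain rfl | hb : b = g.natDegree ∨ b = g.natDegree + 1 := by lia
  · obtain rfl | hc : c = h.natDegree ∨ c = h.natDegree + 1 := by lia
    · exact key
    · rw [hc, resultant_add_right_deg _ _ _ _ 1 le_rfl]
      simpa [hg0] using key
  · obtain rfl : c = h.natDegree := by lia
    rw [hb, resultant_succ_left_deg _ _ _ _ le_rfl]
    simpa [hh0] using key

theorem coeff_coeff_swap {R : Type*} [CommSemiring R] (p : R[X][X]) (i j : ℕ) :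
    ((swap p).coeff i).coeff j = (p.coeff j).coeff i := by
  induction p using Polynomial.induction_on' with
  | add p q hp hq => simp [hp, hq]
  | monomial n a =>
    induction a using Polynomial.induction_on' with
    | add p q hp hq => simp [hp, hq]
    | monomial m a =>
      rw [Bivariate.swap_monomial_monomial]
      simp only [coeff_monomial]
      split_ifs <;> simp_all [coeff_monomial]

theorem natDegree_coeff_swap_le {R : Type*} [CommSemiring R] (p : R[X][X]) (i : ℕ) :
    ((swap p).coeff i).natDegree ≤ p.natDegree := by
  refine natDegree_le_iff_coeff_eq_zero.2 fun j hj => ?_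
  rw [coeff_coeff_swap, coeff_eq_zero_of_natDegree_lt hj, coeff_zero]

theorem map_evalRingHom_swap {R : Type*} [CommRing R] (p : R[X][X]) (x : R) :
    (swap p).map (evalRingHom x) = p.eval (C x) := by
  induction p using Polynomial.induction_on' with
  | add p q hp hq => simp [hp, hq]
  | monomial n a =>
    rw [Bivariate.swap_monomial, Polynomial.map_mul, map_map, map_C, eval_monomial,
      show (evalRingHom x).comp C = RingHom.id R by ext; simp, Polynomial.map_id, coe_evalRingHom,
      eval_pow, eval_X, C_pow]

/-- The polynomial `x ^ a * p (1 / x, y)`, where `a` is the degree of `p` in the inner variable. -/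
noncomputable def innerReverse {R : Type*} [CommSemiring R] (p : R[X][X]) : R[X][X] :=
  swap (reverse (swap p))

theorem map_evalRingHom_eq_innerReverse {K : Type*} [Field K] (p : K[X][X]) {x : K} (hx : x ≠ 0) :
    (innerReverse p).map (evalRingHom x) =
      C (x ^ (swap p).natDegree) * p.map (evalRingHom x⁻¹) := by
  conv_rhs => rw [← Bivariate.swap_swap_apply p, map_evalRingHom_swap, Bivariate.swap_swap_apply]
  rw [innerReverse, map_evalRingHom_swap]
  have hinv : C x * C x⁻¹ = (1 : K[X]) := by rw [← C_mul, mul_inv_cancel₀ hx, C_1]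
  let : Invertible (C x⁻¹ : K[X]) := ⟨C x, hinv, by rw [mul_comm, hinv]⟩
  have := eval₂_reverse_mul_pow (RingHom.id K[X]) (C x⁻¹) (swap p)
  simp only [← eval.eq_1] at this
  have h2 : (⅟(C x⁻¹) : K[X]) = C x := rfl
  rw [h2] at this
  change eval _ _ * _ = eval _ _ at this
  rw [← this, mul_left_comm, C_pow, ← mul_pow, hinv, one_pow, mul_one]

theorem innerReverse_map_evalRingHom_zero {R : Type*} [CommRing R] (p : R[X][X]) :
    (innerReverse p).map (evalRingHom 0) = (swap p).leadingCoeff := by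
  rw [innerReverse, map_evalRingHom_swap, C_0, ← coeff_zero_eq_eval_zero, coeff_zero_reverse]

theorem isUnit_of_natDegree_eq_zero {K : Type*} [Field K] {p : K[X][X]} (hp : p ≠ 0)
    (h₁ : p.natDegree = 0) (h₂ : (swap p).natDegree = 0) : IsUnit p := by
  obtain ⟨q, rfl⟩ := natDegree_eq_zero.1 h₁
  have : q.natDegree = 0 := by
    rw [Bivariate.swap_C, natDegree_map_eq_of_injective C_injective] at h₂
    exact h₂
  obtain ⟨r, rfl⟩ := natDegree_eq_zero.1 this
  have hr : r ≠ 0 := by rintro rfl; simp at hp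
  simpa using hr

/-- A bihomogeneous curve in `ℙ¹ × ℙ¹` without singular points is irreducible: in the affine chart,
the hypotheses `hfin`, `hinf`, `hdeg` express smoothness on the two lines at infinity. -/
theorem irreducible_of_smooth {K : Type*} [Field K] [IsAlgClosed K] (F : K[X][X])
    (hm : F.natDegree ≠ 0) (hn : (swap F).natDegree ≠ 0)
    (hmap : ∀ x, F.map (evalRingHom x) ≠ 0)
    (hfin : ∀ x, F.natDegree ≤ (F.map (evalRingHom x)).natDegree + 1)
    (hinf : Squarefree (swap F).leadingCoeff)
    (hdeg : F.natDegree ≤ (swap F).leadingCoeff.natDegree + 1)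
    (hsmooth : ∀ x y, F.evalEval x y = 0 → (F.map (evalRingHom x)).derivative.eval y = 0 →
      (F.eval (C y)).derivative.eval x ≠ 0) : Irreducible F := by
  have hF0 : F ≠ 0 := by rintro rfl; simp at hm
  refine ⟨fun h => hm (natDegree_eq_zero_of_isUnit h), fun {G H} hGH => ?_⟩
  have hG0 : G ≠ 0 := by rintro rfl; simp [hGH] at hF0
  have hH0 : H ≠ 0 := by rintro rfl; simp [hGH] at hF0
  have hsG0 : swap G ≠ 0 := by simpa using hG0
  have hsH0 : swap H ≠ 0 := by simpa using hH0
  have hmsum : F.natDegree = G.natDegree + H.natDegree := by rw [hGH, natDegree_mul hG0 hH0]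
  have hnsum : (swap F).natDegree = (swap G).natDegree + (swap H).natDegree := by
    rw [hGH, map_mul, natDegree_mul hsG0 hsH0]
  set a₁ := (swap G).natDegree with ha₁
  set a₂ := (swap H).natDegree with ha₂
  set b₁ := G.natDegree with hb₁
  set b₂ := H.natDegree with hb₂
  have hcop (x : K) : IsCoprime (G.map (evalRingHom x)) (H.map (evalRingHom x)) := by
    rw [isCoprime_iff_aeval_ne_zero_of_isAlgClosed K K]
    intro y
    by_contra! hxy
    simp only [coe_aeval_eq_eval, map_evalRingHom_eval] at hxy
    obtain ⟨hGxy, hHxy⟩ := hxy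
    refine hsmooth x y (by simp [hGH, hGxy]) ?_ ?_
    · simp [hGH, derivative_mul, map_evalRingHom_eval, hGxy, hHxy]
    · have e₁ : (G.eval (C y)).eval x = 0 := hGxy
      have e₂ : (H.eval (C y)).eval x = 0 := hHxy
      simp [hGH, derivative_mul, e₁, e₂]
  have hres (x : K) : (resultant G H b₁ b₂).eval x ≠ 0 := by
    have hmul : G.map (evalRingHom x) * H.map (evalRingHom x) = F.map (evalRingHom x) := by
      rw [hGH, Polynomial.map_mul]
    rw [← coe_evalRingHom, ← resultant_map_map]
    refine resultant_ne_zero_of_le_natDegree_mul_succ natDegree_map_le natDegree_map_le (hcop x)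
      (hmul ▸ hmap x) ?_
    rw [hmul, ← hmsum]
    exact hfin x
  have hlc : (swap G).leadingCoeff * (swap H).leadingCoeff = (swap F).leadingCoeff := by
    rw [hGH, map_mul, leadingCoeff_mul]
  have hres' : (resultant (innerReverse G) (innerReverse H) b₁ b₂).eval 0 ≠ 0 := by
    rw [← coe_evalRingHom, ← resultant_map_map, innerReverse_map_evalRingHom_zero,
      innerReverse_map_evalRingHom_zero]
    refine resultant_ne_zero_of_le_natDegree_mul_succ (natDegree_coeff_swap_le _ _)
      (natDegree_coeff_swap_le _ _) ?_ ?_ ?_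
    · rw [← hlc] at hinf
      exact (squarefree_mul_iff.1 hinf).1.isCoprime
    · simp [hG0, hH0]
    · rw [hlc, ← hmsum]
      exact hdeg
  obtain ⟨c, hc⟩ : ∃ c, resultant G H b₁ b₂ = C c := by
    by_contra! hcon
    obtain ⟨x, hx⟩ := IsAlgClosed.exists_root (resultant G H b₁ b₂)
      fun h => hcon _ (eq_C_of_degree_eq_zero h)
    exact hres x hx
  have heq : resultant (innerReverse G) (innerReverse H) b₁ b₂ =
      C c * X ^ (a₁ * b₂ + a₂ * b₁) := by
    refine eq_of_infinite_eval_eq _ _ (Set.Infinite.mono (s := {0}ᶜ) ?_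
      (Set.finite_singleton (0 : K)).infinite_compl)
    intro x hx
    have hx0 : x ≠ 0 := hx
    have h := congr_arg (eval x⁻¹) hc
    rw [← coe_evalRingHom, ← resultant_map_map] at h
    rw [Set.mem_ofPred_eq, ← coe_evalRingHom, ← resultant_map_map,
      map_evalRingHom_eq_innerReverse _ hx0, map_evalRingHom_eq_innerReverse _ hx0,
      resultant_C_mul_left, resultant_C_mul_right, h]
    simp
    ring
  have hN : a₁ * b₂ + a₂ * b₁ = 0 := by
    by_contra hN
    rw [heq, eval_mul, eval_pow, eval_X, zero_pow hN, mul_zero] at hres'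
    exact hres' rfl
  have h1 : a₁ = 0 ∨ b₂ = 0 := by simpa using Nat.eq_zero_of_add_eq_zero_right hN
  have h2 : a₂ = 0 ∨ b₁ = 0 := by simpa using Nat.eq_zero_of_add_eq_zero_left hN
  have : (b₁ = 0 ∧ a₁ = 0) ∨ (b₂ = 0 ∧ a₂ = 0) := by lia
  exact this.imp (fun h => isUnit_of_natDegree_eq_zero hG0 h.1 h.2)
    fun h => isUnit_of_natDegree_eq_zero hH0 h.1 h.2

namespace Polynomial.Chebyshev

section CommRing

variable (R : Type*) [CommRing R]

theorem S_add (a b : ℤ) : S R (a + b) = S R a * S R b - S R (a - 1) * S R (b - 1) := by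
  induction b using Chebyshev.induct with
  | zero => simp
  | one => rw [S_add_one]; simp [mul_comm]
  | add_two n h₁ h₂ =>
    have e₁ := S_add_two R (a + n)
    have e₂ := S_add_two R (n : ℤ)
    have e₃ := S_add_one R (n : ℤ)
    rw [show (n : ℤ) + 1 - 1 = n by ring, show a + ((n : ℤ) + 1) = a + n + 1 by ring] at h₁
    rw [show (n : ℤ) + 2 - 1 = n + 1 by ring, show a + ((n : ℤ) + 2) = a + n + 2 by ring]
    linear_combination e₁ - S R a * e₂ + S R (a - 1) * e₃ + X * h₁ - h₂
  | neg_add_one n h₁ h₂ =>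
    have e₁ := S_sub_one R (a + -n)
    have e₂ := S_sub_one R (-n : ℤ)
    have e₃ := S_sub_two R (-n : ℤ)
    rw [show -(n : ℤ) + 1 - 1 = -n by ring, show a + (-(n : ℤ) + 1) = a + -n + 1 by ring] at h₂
    rw [show -(n : ℤ) - 1 - 1 = -n - 2 by ring, show a + (-(n : ℤ) - 1) = a + -n - 1 by ring]
    linear_combination e₁ - S R a * e₂ + S R (a - 1) * e₃ + X * h₁ - h₂

theorem S_two_mul (n : ℤ) : S R (2 * n) = S R n ^ 2 - S R (n - 1) ^ 2 := by
  rw [two_mul, S_add]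
  ring

theorem S_sq_add_S_sub_one_sq (n : ℤ) :
    S R n ^ 2 + S R (n - 1) ^ 2 - X * S R n * S R (n - 1) = 1 := by
  have := S_sq_add_S_sq R (n - 1)
  rw [sub_add_cancel] at this
  linear_combination this

theorem X_sq_sub_four_mul_derivative_S (n : ℤ) :
    (X ^ 2 - 4) * derivative (S R n) =
      (n : R[X]) * X * S R n - 2 * ((n : R[X]) + 1) * S R (n - 1) := by
  induction n using Chebyshev.induct with
  | zero => simp
  | one => simp; ring
  | add_two n h₁ h₂ =>
    have e₁ := S_add_two R (n : ℤ)
    have e₂ := S_add_one R (n : ℤ)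
    have e₃ := congr_arg derivative e₁
    simp only [derivative_sub, derivative_mul, derivative_X] at e₃
    rw [show (n : ℤ) + 1 - 1 = n by ring] at h₁
    rw [show (n : ℤ) + 2 - 1 = n + 1 by ring]
    push_cast at *
    linear_combination (X ^ 2 - 4) * e₃ + X * h₁ - h₂ - (n + 2) * X * e₁ + 2 * (n + 1) * e₂
  | neg_add_one n h₁ h₂ =>
    have e₁ := S_sub_one R (-n : ℤ)
    have e₂ := S_sub_two R (-n : ℤ)
    have e₃ := congr_arg derivative e₁
    simp only [derivative_sub, derivative_mul, derivative_X] at e₃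
    rw [show -(n : ℤ) + 1 - 1 = -n by ring] at h₂
    rw [show -(n : ℤ) - 1 - 1 = -n - 2 by ring]
    push_cast at *
    linear_combination (X ^ 2 - 4) * e₃ + X * h₁ - h₂ - (-n + 1) * X * e₁ + 2 * (-n) * e₂

theorem X_sq_sub_four_mul_wronskian_S (n : ℤ) :
    (X ^ 2 - 4) * wronskian (S R (n - 1)) (S R n) =
      S R (2 * n) - (2 * (n : R[X]) + 1) := by
  have h₁ := X_sq_sub_four_mul_derivative_S R n
  have h₂ := X_sq_sub_four_mul_derivative_S R (n - 1)
  have h₃ := S_sq_add_S_sub_one_sq R n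
  have h₄ := S_sub_two R n
  rw [show n - 1 - 1 = n - 2 by ring] at h₂
  rw [wronskian, S_two_mul]
  push_cast at *
  linear_combination S R (n - 1) * h₁ - S R n * h₂ - (2 * n + 1) * h₃ + 2 * n * S R n * h₄

theorem wronskian_S_succ (n : ℤ) :
    wronskian (S R n) (S R (n + 1)) = wronskian (S R (n - 1)) (S R n) + S R n ^ 2 := by
  rw [wronskian, wronskian, S_add_one]
  simp only [derivative_sub, derivative_mul, derivative_X]
  ring

theorem isMonicOfDegree_S [Nontrivial R] (n : ℕ) : IsMonicOfDegree (S R n) n := by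
  induction n using Nat.twoStepInduction with
  | zero => simp
  | one => simpa using isMonicOfDegree_X R
  | more n h₁ h₂ =>
    rw [Nat.cast_add, Nat.cast_two, S_add_two]
    push_cast at h₂
    have := (isMonicOfDegree_X R).mul h₂
    rw [show 1 + (n + 1) = n + 2 by ring] at this
    exact this.sub (by rw [h₁.natDegree_eq]; lia)

theorem eq_S_of_recurrence {f : ℤ → R[X]} (h₀ : f 0 = 1) (h₁ : f 1 = X)
    (h : ∀ j, f (j + 1) = X * f j - f (j - 1)) (n : ℤ) : f n = S R n := by
  induction n using Chebyshev.induct with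
  | zero => simpa using h₀
  | one => simpa using h₁
  | add_two n h₂ h₃ =>
    have := h (n + 1)
    rw [add_sub_cancel_right, h₂, h₃, add_assoc, one_add_one_eq_two] at this
    rw [this, S_add_two]
  | neg_add_one n h₂ h₃ =>
    have := h (-n)
    rw [h₂, h₃] at this
    rw [S_sub_one, this]
    ring

end CommRing

theorem eval_S_ne_zero_or {K : Type*} [Field K] (n : ℤ) (t : K) :
    (S K n).eval t ≠ 0 ∨ (S K (n - 1)).eval t ≠ 0 := by
  by_contra! h
  simpa [h] using congr_arg (eval t) (S_sq_add_S_sub_one_sq K n)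

theorem eval_S_two_mul_of_wronskian {K : Type*} [Field K] {n : ℤ} {t : K}
    (h : (wronskian (S K (n - 1)) (S K n)).eval t = 0) : (S K (2 * n)).eval t = 2 * n + 1 := by
  have := congr_arg (eval t) (X_sq_sub_four_mul_wronskian_S K n)
  rw [eval_mul, h, mul_zero] at this
  simp at this
  linear_combination -this

theorem squarefree_S {K : Type*} [Field K] [CharZero K] [IsAlgClosed K] (n : ℕ) :
    Squarefree (S K n) := by
  refine Separable.squarefree ?_
  rw [separable_def, isCoprime_iff_aeval_ne_zero_of_isAlgClosed K K]
  intro t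
  by_contra! ht
  simp only [coe_aeval_eq_eval] at ht
  have h₁ := eval_S_two_mul_of_wronskian (n := n) (t := t) (by simp [wronskian, ht.1, ht.2])
  have h₂ := congr_arg (eval t) (S_sq_add_S_sub_one_sq K n)
  rw [S_two_mul] at h₁
  simp only [eval_sub, eval_add, eval_mul, eval_pow, ht.1, eval_one] at h₁ h₂
  push_cast at h₁
  have : ((2 * n + 2 : ℕ) : K) = 0 := by push_cast; linear_combination -h₁ - h₂
  exact absurd this (Nat.cast_ne_zero.2 (by lia))

theorem wronskian_S_eval_pos (n : ℕ) (x : ℝ) :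
    0 < (wronskian (S ℝ n) (S ℝ (n + 1))).eval x := by
  induction n with
  | zero => simp [wronskian]
  | succ n ih =>
    rw [wronskian_S_succ]
    push_cast
    rw [add_sub_cancel_right, eval_add, eval_pow]
    positivity

theorem sin_eq_mk (z : ℂ) :
    Complex.sin z = ⟨Real.sin z.re * Real.cosh z.im, Real.cos z.re * Real.sinh z.im⟩ := by
  rw [Complex.sin_eq, Complex.mk_eq_add_mul_I]
  push_cast
  rfl

theorem normSq_sin (z : ℂ) :
    Complex.normSq (Complex.sin z) = Real.sin z.re ^ 2 + Real.sinh z.im ^ 2 := by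
  rw [sin_eq_mk, Complex.normSq_mk]
  linear_combination Real.sin z.re ^ 2 * Real.cosh_sq z.im +
    Real.sinh z.im ^ 2 * Real.sin_sq_add_cos_sq z.re

/-- At a critical point of `S n / S (n - 1)`, the value of this rational function lies outside
the closed unit disc. -/
theorem norm_eval_S_sub_one_lt {n : ℕ} (hn : n ≠ 0) {t : ℂ}
    (h : (wronskian (S ℂ (n - 1)) (S ℂ n)).eval t = 0) :
    ‖(S ℂ (n - 1)).eval t‖ < ‖(S ℂ n).eval t‖ := by
  have hreal (x : ℝ) : t ≠ x := by
    rintro rfl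
    obtain ⟨k, rfl⟩ := Nat.exists_eq_succ_of_ne_zero hn
    have hmap : wronskian (S ℂ k) (S ℂ (k + 1)) =
        (wronskian (S ℝ k) (S ℝ (k + 1))).map Complex.ofRealHom := by
      simp [wronskian, ← derivative_map]
    push_cast at h
    rw [add_sub_cancel_right, hmap, ← Complex.ofRealHom_eq_coe, eval_map_apply,
      Complex.ofRealHom_eq_coe, Complex.ofReal_eq_zero] at h
    exact (wronskian_S_eval_pos k x).ne' h
  obtain ⟨θ, hθ⟩ := Complex.cos_surjective (t / 2)
  obtain rfl : t = 2 * Complex.cos θ := by rw [hθ]; ring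
  have hb : θ.im ≠ 0 := fun h0 => hreal (2 * Real.cos θ.re) (by
    conv_lhs => rw [← Complex.re_add_im θ, h0]
    simp)
  have hs : Complex.sin θ ≠ 0 := fun h0 => by
    have h1 := Complex.sin_sq_add_cos_sq θ
    rw [h0, zero_pow two_ne_zero, zero_add, sq_eq_one_iff] at h1
    obtain h1 | h1 := h1
    · exact hreal 2 (by simp [h1])
    · exact hreal (-2) (by simp [h1])
  have hcrit : Complex.sin ((2 * n + 1) * θ) = (2 * n + 1) * Complex.sin θ := by
    have := S_two_mul_complex_cos θ (2 * n)
    rw [eval_S_two_mul_of_wronskian h] at this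
    push_cast at this
    exact this.symm
  have hA := S_two_mul_complex_cos θ n
  have hB := S_two_mul_complex_cos θ (n - 1)
  push_cast at hA hB
  rw [sub_add_cancel] at hB
  suffices Complex.normSq (Complex.sin (n * θ)) < Complex.normSq (Complex.sin ((n + 1) * θ)) by
    rw [← hA, ← hB, Complex.normSq_mul, Complex.normSq_mul] at this
    have := lt_of_mul_lt_mul_right this (Complex.normSq_nonneg _)
    rw [Complex.normSq_eq_norm_sq, Complex.normSq_eq_norm_sq] at this
    exact lt_of_pow_lt_pow_left₀ 2 (norm_nonneg _) this
  have hre (k : ℕ) : ((k : ℂ) * θ).re = k * θ.re := by simp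
  have him (k : ℕ) : ((k : ℂ) * θ).im = k * θ.im := by simp
  have hn1 : (n + 1 : ℂ) = (n + 1 : ℕ) := by push_cast; rfl
  have hl : (2 * n + 1 : ℂ) = (2 * n + 1 : ℕ) := by push_cast; rfl
  rw [hn1, normSq_sin, normSq_sin, hre, hre, him, him]
  set a := θ.re
  set b := θ.im
  have hcrit' : Real.sin ((2 * n + 1) * a) * Real.cosh ((2 * n + 1) * b) =
      (2 * n + 1) * (Real.sin a * Real.cosh b) := by
    rw [hl, sin_eq_mk, sin_eq_mk θ, hre, him] at hcrit
    simpa using congr_arg Complex.re hcrit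
  have h₁ : 0 ≤ Real.sin ((2 * n + 1) * a) * Real.sin a := by
    refine nonneg_of_mul_nonneg_left (b := Real.cosh ((2 * n + 1) * b)) ?_ (Real.cosh_pos _)
    have : 0 ≤ (2 * n + 1) * (Real.sin a ^ 2 * Real.cosh b) := by
      have := Real.cosh_pos b
      positivity
    linarith [congr_arg (· * Real.sin a) hcrit']
  have h₂ : 0 < Real.sinh ((2 * n + 1) * b) * Real.sinh b := by
    obtain hb | hb := hb.lt_or_gt
    · exact mul_pos_of_neg_of_neg (Real.sinh_neg_iff.2 (mul_neg_of_pos_of_neg (by positivity) hb))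
        (Real.sinh_neg_iff.2 hb)
    · exact mul_pos (Real.sinh_pos_iff.2 (by positivity)) (Real.sinh_pos_iff.2 hb)
  rw [show (2 * n + 1) * a = (n + 1) * a + n * a by ring] at h₁
  rw [show (2 * n + 1) * b = (n + 1) * b + n * b by ring] at h₂
  have e₁ := Real.sin_sub ((n + 1) * a) (n * a)
  have e₂ := Real.sinh_sub ((n + 1) * b) (n * b)
  rw [show (n + 1) * a - n * a = a by ring] at e₁
  rw [show (n + 1) * b - n * b = b by ring] at e₂
  rw [Real.sin_add, e₁] at h₁
  rw [Real.sinh_add, e₂] at h₂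
  push_cast
  have f₁ := Real.sin_sq_add_cos_sq ((n + 1) * a)
  have f₂ := Real.sin_sq_add_cos_sq (n * a)
  have f₃ := Real.cosh_sq ((n + 1) * b)
  have f₄ := Real.cosh_sq (n * b)
  have g₁ : 0 ≤ Real.sin ((n + 1) * a) ^ 2 - Real.sin (n * a) ^ 2 := by
    convert h₁ using 1
    linear_combination Real.sin (n * a) ^ 2 * f₁ - Real.sin ((n + 1) * a) ^ 2 * f₂
  have g₂ : 0 < Real.sinh ((n + 1) * b) ^ 2 - Real.sinh (n * b) ^ 2 := by
    convert h₂ using 1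
    linear_combination Real.sinh (n * b) ^ 2 * f₃ - Real.sinh ((n + 1) * b) ^ 2 * f₄
  linarith

theorem isIntegral_eval_S {t : ℂ} (ht : IsIntegral ℤ t) (n : ℤ) :
    IsIntegral ℤ ((S ℂ n).eval t) := by
  have h : (S ℂ n).eval t = aeval t (S ℤ n) := by
    rw [← map_S (algebraMap ℤ ℂ), eval_map_algebraMap]
  rw [h]
  exact IsIntegral.of_mem_of_fg _ ht.fg_adjoin_singleton _ (aeval_mem_adjoin_singleton ℤ t)

theorem isIntegral_of_eval_S_eq_intCast {n : ℕ} (hn : n ≠ 0) {t : ℂ} {a : ℤ}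
    (h : (S ℂ n).eval t = a) : IsIntegral ℤ t := by
  have hmon := isMonicOfDegree_S ℤ n
  refine ⟨S ℤ n - Polynomial.C a, (hmon.sub (by simpa using Nat.pos_of_ne_zero hn)).monic, ?_⟩
  rw [← eval_map, Polynomial.map_sub, map_S]
  simp [h]

theorem isIntegral_of_wronskian_S {n : ℤ} (hn₀ : n ≠ 0) (hn₁ : n ≠ -1) {t : ℂ}
    (h : (wronskian (S ℂ (n - 1)) (S ℂ n)).eval t = 0) : IsIntegral ℤ t := by
  have key := eval_S_two_mul_of_wronskian h
  obtain hn | hn := le_or_gt 0 n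
  · lift n to ℕ using hn
    refine isIntegral_of_eval_S_eq_intCast (n := 2 * n) (a := 2 * n + 1) (by lia) ?_
    push_cast at key ⊢
    exact key
  · obtain ⟨k, rfl⟩ : ∃ k : ℕ, n = -k - 1 := ⟨(-n - 1).toNat, by lia⟩
    refine isIntegral_of_eval_S_eq_intCast (n := 2 * k) (a := 2 * k + 1) (by lia) ?_
    rw [show 2 * (-(k : ℤ) - 1) = -(2 * k : ℤ) - 2 by ring, S_neg_sub_two] at key
    push_cast at key ⊢
    rw [eval_neg] at key
    linear_combination -key

theorem _root_.Int.dvd_of_isIntegral {a b : ℤ} {u : ℂ} (hu : IsIntegral ℤ u) (h : (b : ℂ) = u * a) :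
    a ∣ b := by
  obtain rfl | ha := eq_or_ne a 0
  · simpa using h
  have ha' : (a : ℂ) ≠ 0 := by exact_mod_cast ha
  have hq : IsIntegral ℤ (b / a : ℚ) := by
    rw [← isIntegral_algebraMap_iff (B := ℂ) (algebraMap ℚ ℂ).injective]
    convert hu
    rw [eq_ratCast]
    push_cast
    field_simp
    rw [h]
    ring
  obtain ⟨c, hc⟩ := IsIntegrallyClosed.algebraMap_eq_of_integral hq
  refine ⟨c, ?_⟩
  have haq : (a : ℚ) ≠ 0 := by exact_mod_cast ha
  have : (b : ℚ) = a * c := by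
    rw [show (c : ℚ) = b / a from hc]
    field_simp
  exact_mod_cast this

theorem dvd_of_eval_S_mul_eq {m n : ℤ} {t z : ℂ} (hm₀ : m ≠ 0) (hm₁ : m ≠ -1) (hn₀ : n ≠ 0)
    (hn₁ : n ≠ -1) (ht : (wronskian (S ℂ (n - 1)) (S ℂ n)).eval t = 0)
    (hz : (wronskian (S ℂ (m - 1)) (S ℂ m)).eval z = 0)
    (h : (S ℂ n).eval t * (S ℂ (m - 1)).eval z = (S ℂ (n - 1)).eval t * (S ℂ m).eval z) :
    2 * n + 1 ∣ 2 * m + 1 := by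
  have hti := isIntegral_of_wronskian_S hn₀ hn₁ ht
  have hzi := isIntegral_of_wronskian_S hm₀ hm₁ hz
  have e₁ := eval_S_two_mul_of_wronskian ht
  have e₂ := eval_S_two_mul_of_wronskian hz
  have e₃ := congr_arg (eval t) (S_sq_add_S_sub_one_sq ℂ n)
  rw [S_two_mul, eval_sub, eval_pow, eval_pow] at e₁ e₂
  simp only [eval_sub, eval_add, eval_mul, eval_pow, eval_X, eval_one] at e₃
  have ha := isIntegral_eval_S hti n
  have hb := isIntegral_eval_S hti (n - 1)
  have hc := isIntegral_eval_S hzi m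
  have hd := isIntegral_eval_S hzi (m - 1)
  set a := (S ℂ n).eval t
  set b := (S ℂ (n - 1)).eval t
  set c := (S ℂ m).eval z
  set d := (S ℂ (m - 1)).eval z
  have hu : IsIntegral ℤ (c * (a - t * b) + d * b) := (hc.mul (ha.sub (hti.mul hb))).add (hd.mul hb)
  refine Int.dvd_of_isIntegral (hu.pow 2) ?_
  have hc' : c = (c * (a - t * b) + d * b) * a := by linear_combination -c * e₃ - b * h
  have hd' : d = (c * (a - t * b) + d * b) * b := by
    linear_combination -d * e₃ - (t * b - a) * h
  push_cast
  rw [← e₁, ← e₂]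
  linear_combination (c + (c * (a - t * b) + d * b) * a) * hc' -
    (d + (c * (a - t * b) + d * b) * b) * hd'

/-- The curve `S n t * S (m - 1) z = S (n - 1) t * S m z` has no affine singular point. -/
theorem not_common_critical_value {m : ℕ} {n : ℤ} {t z : ℂ} (hm : m ≠ 0) (hn₀ : n ≠ 0)
    (hn₁ : n ≠ -1) (hmn : n ≠ m) (ht : (wronskian (S ℂ (n - 1)) (S ℂ n)).eval t = 0)
    (hz : (wronskian (S ℂ (m - 1)) (S ℂ m)).eval z = 0) :
    (S ℂ n).eval t * (S ℂ (m - 1)).eval z ≠ (S ℂ (n - 1)).eval t * (S ℂ m).eval z := by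
  intro h
  have h₁ := dvd_of_eval_S_mul_eq (by lia) (by lia) hn₀ hn₁ ht hz h
  have h₂ := dvd_of_eval_S_mul_eq hn₀ hn₁ (by lia) (by lia) hz ht (by linear_combination -h)
  obtain h₃ | h₃ := Int.natAbs_eq_natAbs_iff.1 (Int.natAbs_eq_of_dvd_dvd h₁ h₂)
  · lia
  obtain rfl : n = -m - 1 := by lia
  have e₁ : S ℂ (-m - 1) = -S ℂ (m - 1) := S_neg_sub_one ℂ m
  have e₂ : S ℂ (-m - 1 - 1) = -S ℂ m := by rw [sub_sub, one_add_one_eq_two, S_neg_sub_two]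
  rw [e₁, e₂] at ht h
  have ht' : (wronskian (S ℂ (m - 1)) (S ℂ m)).eval t = 0 := by
    rw [← neg_eq_zero, ← ht]
    simp [wronskian]
    ring
  have n₁ := norm_eval_S_sub_one_lt hm ht'
  have n₂ := norm_eval_S_sub_one_lt hm hz
  refine (mul_lt_mul'' n₁ n₂ (norm_nonneg _) (norm_nonneg _)).ne ?_
  rw [← norm_mul, ← norm_mul]
  simpa using congr_arg norm h

end Polynomial.Chebyshev

theorem natDegree_and_leadingCoeff_C_mul_sub {R : Type*} [CommRing R] {c d : R[X]} {m : ℕ}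
    (hc : IsMonicOfDegree c m) (hd : d.natDegree < m) (p : R) {q : R} (hq : q ≠ 0) :
    (C p * d - C q * c).natDegree = m ∧ (C p * d - C q * c).leadingCoeff = -q := by
  have hcoeff : (C p * d - C q * c).coeff m = -q := by
    rw [coeff_sub, coeff_C_mul, coeff_C_mul, coeff_eq_zero_of_natDegree_lt hd, ← hc.natDegree_eq,
      hc.monic.coeff_natDegree]
    ring
  have hle : (C p * d - C q * c).natDegree ≤ m := by
    simpa using natDegree_sub_le_of_le ((natDegree_C_mul_le p d).trans hd.le)
      ((natDegree_C_mul_le q c).trans hc.natDegree_eq.le)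
  have hdeg : (C p * d - C q * c).natDegree = m :=
    natDegree_eq_of_le_of_coeff_ne_zero hle (by rw [hcoeff]; exact neg_ne_zero.2 hq)
  exact ⟨hdeg, by rw [leadingCoeff, hdeg, hcoeff]⟩

namespace Polynomial.Chebyshev

theorem S_ne_zero {K : Type*} [Field K] [CharZero K] {n : ℤ} (hn : n ≠ -1) : S K n ≠ 0 := by
  obtain h | h := le_or_gt 0 n
  · lift n to ℕ using h
    exact (isMonicOfDegree_S K n).ne_zero
  · obtain ⟨k, rfl⟩ : ∃ k : ℕ, n = -k - 2 := ⟨(-n - 2).toNat, by lia⟩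
    rw [S_neg_sub_two]
    exact neg_ne_zero.2 (isMonicOfDegree_S K k).ne_zero

/-- The polynomial `S n (t) * S (m - 1) (z) - S (n - 1) (t) * S m (z)`, with `t` the inner
variable and `z` the outer one. -/
noncomputable def bivariateS (m n : ℤ) : ℂ[X][X] :=
  Polynomial.C (S ℂ n) * (S ℂ (m - 1)).map Polynomial.C -
    Polynomial.C (S ℂ (n - 1)) * (S ℂ m).map Polynomial.C

theorem map_bivariateS (m n : ℤ) (x : ℂ) : (bivariateS m n).map (evalRingHom x) =
    Polynomial.C ((S ℂ n).eval x) * S ℂ (m - 1) -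
      Polynomial.C ((S ℂ (n - 1)).eval x) * S ℂ m := by
  simp only [bivariateS, Polynomial.map_sub, Polynomial.map_mul, Polynomial.map_C, map_map,
    coe_evalRingHom, show (evalRingHom x).comp Polynomial.C = RingHom.id ℂ by ext; simp,
    Polynomial.map_id]

theorem swap_bivariateS (m n : ℤ) : swap (bivariateS m n) =
    Polynomial.C (S ℂ (m - 1)) * (S ℂ n).map Polynomial.C -
      Polynomial.C (S ℂ m) * (S ℂ (n - 1)).map Polynomial.C := by
  simp only [bivariateS, map_sub, map_mul, Bivariate.swap_C, Bivariate.swap_map_C]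
  ring

theorem bivariateS_neg_sub_one (m n : ℤ) : bivariateS (-m - 1) (-n - 1) = -bivariateS m n := by
  have h (j : ℤ) : S ℂ (-j - 1 - 1) = -S ℂ j := by
    rw [sub_sub, one_add_one_eq_two, S_neg_sub_two]
  rw [bivariateS, bivariateS, h, h, S_neg_sub_one, S_neg_sub_one]
  simp only [Polynomial.map_neg, Polynomial.C_neg]
  ring

theorem isMonicOfDegree_map_C_S (n : ℕ) :
    IsMonicOfDegree ((S ℂ n).map (Polynomial.C : ℂ →+* ℂ[X])) n := by
  rw [map_S]
  exact isMonicOfDegree_S _ n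

/-- The degree and the leading coefficient of `bivariateS m n` in `t`. -/
theorem swap_bivariateS_natDegree_ne_zero {k : ℕ} {n : ℤ} (hn₀ : n ≠ 0) (hn₁ : n ≠ -1) :
    (swap (bivariateS (k + 1 : ℕ) n)).natDegree ≠ 0 ∧
      ∃ j : ℕ, k ≤ j ∧ ((swap (bivariateS (k + 1 : ℕ) n)).leadingCoeff = S ℂ j) := by
  have hS (j : ℕ) : S ℂ j ≠ 0 := (isMonicOfDegree_S ℂ j).ne_zero
  have hk : ((k + 1 : ℕ) : ℤ) - 1 = k := by push_cast; ring
  rw [swap_bivariateS, hk]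
  obtain hn | hn := le_or_gt 0 n
  · obtain ⟨l, rfl⟩ : ∃ l : ℕ, n = (l + 1 : ℕ) := ⟨(n - 1).toNat, by lia⟩
    have hl : ((l + 1 : ℕ) : ℤ) - 1 = l := by push_cast; ring
    have := natDegree_and_leadingCoeff_C_mul_sub (isMonicOfDegree_map_C_S (l + 1))
      (d := (S ℂ l).map Polynomial.C) (by rw [(isMonicOfDegree_map_C_S l).natDegree_eq]; lia)
      (-S ℂ (k + 1 : ℕ)) (neg_ne_zero.2 (hS k))
    rw [hl, show ∀ a b c d : ℂ[X][X], a * b - c * d = -c * d - -a * b by intros; ring,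
      ← Polynomial.C_neg, ← Polynomial.C_neg, this.1, this.2]
    exact ⟨by lia, k, le_rfl, neg_neg _⟩
  · obtain ⟨l, rfl⟩ : ∃ l : ℕ, n = -(l : ℤ) - 2 := ⟨(-n - 2).toNat, by lia⟩
    have hl : -(l : ℤ) - 2 - 1 = -(l + 1 : ℕ) - 2 := by push_cast; ring
    have := natDegree_and_leadingCoeff_C_mul_sub (isMonicOfDegree_map_C_S (l + 1))
      (d := (S ℂ l).map Polynomial.C) (by rw [(isMonicOfDegree_map_C_S l).natDegree_eq]; lia)
      (-S ℂ k) (neg_ne_zero.2 (hS (k + 1)))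
    rw [hl, S_neg_sub_two, S_neg_sub_two, Polynomial.map_neg, Polynomial.map_neg,
      show ∀ a b c d : ℂ[X][X], a * -b - c * -d = -a * b - -c * d by intros; ring,
      ← Polynomial.C_neg, ← Polynomial.C_neg, this.1, this.2]
    exact ⟨by lia, k + 1, by lia, neg_neg _⟩

theorem irreducible_bivariateS_of_pos {m : ℕ} {n : ℤ} (hm : m ≠ 0) (hn₀ : n ≠ 0) (hn₁ : n ≠ -1)
    (hmn : n ≠ m) : Irreducible (bivariateS m n) := by
  obtain ⟨k, rfl⟩ := Nat.exists_eq_succ_of_ne_zero hm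
  have hk : ((k.succ : ℕ) : ℤ) - 1 = k := by push_cast; ring
  have hdeg : (bivariateS k.succ n).natDegree = k + 1 := by
    rw [bivariateS, hk]
    exact (natDegree_and_leadingCoeff_C_mul_sub (isMonicOfDegree_map_C_S (k + 1))
      (by rw [(isMonicOfDegree_map_C_S k).natDegree_eq]; lia) _ (S_ne_zero (by lia))).1
  obtain ⟨hswap, j, hkj, hlc⟩ := swap_bivariateS_natDegree_ne_zero (k := k) hn₀ hn₁
  have hfiber (x : ℂ) : (bivariateS k.succ n).map (evalRingHom x) ≠ 0 ∧
      k ≤ ((bivariateS k.succ n).map (evalRingHom x)).natDegree := by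
    rw [map_bivariateS, hk]
    by_cases hq : (S ℂ (n - 1)).eval x = 0
    · have hp := (eval_S_ne_zero_or n x).resolve_right (by simpa using hq)
      rw [hq, Polynomial.C_0, zero_mul, sub_zero, Polynomial.natDegree_C_mul hp,
        (isMonicOfDegree_S ℂ k).natDegree_eq]
      exact ⟨mul_ne_zero (Polynomial.C_ne_zero.2 hp) (isMonicOfDegree_S ℂ k).ne_zero, le_rfl⟩
    · have := natDegree_and_leadingCoeff_C_mul_sub (isMonicOfDegree_S ℂ (k + 1))
        (d := S ℂ k) (by rw [(isMonicOfDegree_S ℂ k).natDegree_eq]; lia) ((S ℂ n).eval x) hq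
      refine ⟨fun h0 => ?_, this.1.symm ▸ k.le_succ⟩
      have h1 := this.1
      rw [h0, natDegree_zero] at h1
      lia
  refine irreducible_of_smooth _ (by lia) hswap (fun x => (hfiber x).1)
    (fun x => by have := (hfiber x).2; lia) (hlc ▸ squarefree_S j) ?_ fun x y h₀ h₁ h₂ => ?_
  · rw [hlc, (isMonicOfDegree_S ℂ j).natDegree_eq]
    lia
  · rw [map_bivariateS] at h₁
    have h₀' : (S ℂ n).eval x * (S ℂ (k.succ - 1)).eval y =
        (S ℂ (n - 1)).eval x * (S ℂ k.succ).eval y := by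
      rw [← map_evalRingHom_eval, map_bivariateS] at h₀
      simpa [sub_eq_zero] using h₀
    rw [← map_evalRingHom_swap, swap_bivariateS] at h₂
    simp only [Polynomial.map_sub, Polynomial.map_mul, Polynomial.map_C, map_map, coe_evalRingHom,
      show (evalRingHom y).comp Polynomial.C = RingHom.id ℂ by ext; simp, Polynomial.map_id,
      derivative_sub, derivative_mul, Polynomial.derivative_C, eval_sub, eval_mul,
      Polynomial.eval_C, zero_mul, zero_add] at h₁ h₂
    refine not_common_critical_value hm hn₀ hn₁ hmn ?_ ?_ h₀'
    · obtain h | h := eval_S_ne_zero_or (k.succ : ℤ) y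
      · refine (mul_eq_zero.1 ?_).resolve_left h
        simp only [wronskian, eval_sub, eval_mul]
        linear_combination (derivative (S ℂ n)).eval x * -h₀' + (S ℂ n).eval x * h₂
      · refine (mul_eq_zero.1 ?_).resolve_left h
        simp only [wronskian, eval_sub, eval_mul]
        linear_combination (derivative (S ℂ (n - 1))).eval x * -h₀' + (S ℂ (n - 1)).eval x * h₂
    · obtain h | h := eval_S_ne_zero_or n x
      · refine (mul_eq_zero.1 ?_).resolve_left h
        simp only [wronskian, eval_sub, eval_mul]
        linear_combination (derivative (S ℂ k.succ)).eval y * h₀' - (S ℂ k.succ).eval y * h₁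
      · refine (mul_eq_zero.1 ?_).resolve_left h
        simp only [wronskian, eval_sub, eval_mul]
        linear_combination (derivative (S ℂ (k.succ - 1))).eval y * h₀' -
          (S ℂ (k.succ - 1)).eval y * h₁

theorem irreducible_bivariateS {m n : ℤ} (hm₀ : m ≠ 0) (hm₁ : m ≠ -1) (hn₀ : n ≠ 0)
    (hn₁ : n ≠ -1) (hmn : n ≠ m) : Irreducible (bivariateS m n) := by
  obtain hm | hm := le_or_gt 0 m
  · lift m to ℕ using hm
    exact irreducible_bivariateS_of_pos (by lia) hn₀ hn₁ hmn
  · obtain ⟨k, hk⟩ : ∃ k : ℕ, -m - 1 = k := ⟨(-m - 1).toNat, by lia⟩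
    have := irreducible_bivariateS_of_pos (m := k) (n := -n - 1) (by lia) (by lia) (by lia) (by lia)
    rw [← hk, bivariateS_neg_sub_one] at this
    exact (Associated.refl _).neg_left.irreducible this

theorem map_eval_S {R R' : Type*} [CommRing R] [CommRing R'] (f : R →+* R') (x : R) (n : ℤ) :
    f ((S R n).eval x) = (S R' n).eval (f x) := by
  rw [← map_S f, eval_map_apply]

theorem eval_X_S (R : Type*) [CommRing R] (n : ℤ) : (S R[X] n).eval X = S R n := by
  rw [← map_S Polynomial.C, eval_map, eval₂_C_X]

theorem equivMvPolynomial_bivariateS (m n : ℤ) :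
    Bivariate.equivMvPolynomial ℂ (bivariateS m n) =
      aeval (MvPolynomial.X 0) (S ℤ n) * aeval (MvPolynomial.X 1) (S ℤ (m - 1)) -
        aeval (MvPolynomial.X 0) (S ℤ (n - 1)) * aeval (MvPolynomial.X 1) (S ℤ m) := by
  have h₀ (j : ℤ) : Bivariate.equivMvPolynomial ℂ (Polynomial.C (S ℂ j)) =
      aeval (MvPolynomial.X 0) (S ℤ j) := by
    rw [aeval_S, ← Bivariate.equivMvPolynomial_C_X, ← eval_X_S, map_eval_S]
    exact map_eval_S (Bivariate.equivMvPolynomial ℂ : ℂ[X][X] →+* MvPolynomial (Fin 2) ℂ) _ j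
  have h₁ (j : ℤ) : Bivariate.equivMvPolynomial ℂ ((S ℂ j).map Polynomial.C) =
      aeval (MvPolynomial.X 1) (S ℤ j) := by
    rw [aeval_S, ← Bivariate.equivMvPolynomial_X, map_S, ← eval_X_S]
    exact map_eval_S (Bivariate.equivMvPolynomial ℂ : ℂ[X][X] →+* MvPolynomial (Fin 2) ℂ) _ j
  simp only [bivariateS, map_sub, map_mul, h₀, h₁]

end Polynomial.Chebyshev

end

/-- Let `k = 2m+1` and `l = 2n+1` be odd integers with `|k| > 1`, `|l| > 1`
and `k ≠ l`.  Then the polynomial `F(t,z) = S_n(t)·S_{m−1}(z) − S_{n−1}(t)·S_m(z)` is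
irreducible in `ℂ[t,z]` (with `t` the variable `X 0` and `z` the variable `X 1`).
Here `S : ℤ → ℤ[ω]` satisfies `S 0 = 1`, `S 1 = ω` and `S (j+1) = ω·S j − S (j−1)`
for all `j`. -/
theorem statement15 (S : ℤ → Polynomial ℤ)
    (hS0 : S 0 = 1) (hS1 : S 1 = X)
    (hSrec : ∀ j : ℤ, S (j + 1) = X * S j - S (j - 1))
    (m n : ℤ) (hk : 1 < |2 * m + 1|) (hl : 1 < |2 * n + 1|)
    (hne : 2 * m + 1 ≠ 2 * n + 1)
    (F : MvPolynomial (Fin 2) ℂ)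
    (hF : F = Polynomial.aeval (MvPolynomial.X 0) (S n) *
          Polynomial.aeval (MvPolynomial.X 1) (S (m - 1)) -
        Polynomial.aeval (MvPolynomial.X 0) (S (n - 1)) *
          Polynomial.aeval (MvPolynomial.X 1) (S m)) :
    Irreducible F := by
  obtain rfl : S = Chebyshev.S ℤ := funext (Chebyshev.eq_S_of_recurrence ℤ hS0 hS1 hSrec)
  rw [hF, ← Chebyshev.equivMvPolynomial_bivariateS, MulEquiv.irreducible_iff]
  rw [lt_abs] at hk hl
  exact Chebyshev.irreducible_bivariateS (by lia) (by lia) (by lia) (by lia) (by lia)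
end
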